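/- arXiv:0710.3964 — 5 statements merged into one kernel-verified Lean document; each statement's English description precedes it below -/
import Mathlib

section
/- For all real numbers x > 0 and w > 0, Euler's constant satisfies γ = w/2 − log(x) − w·Σ_{k=0}^{∞} exp(−x·e^{wk}) + w·Σ_{k=1}^{∞} ((−1)^{k+1}/k!)·x^k/(e^{wk} − 1) + Σ_{k ∈ ℤ, k ≠ 0} Γ(2πik/w)·x^{−2πik/w}, where Γ is the complex Gamma function, γ is the Euler–Mascheroni constant, and x^{−2πik/w} denotes the principal-branch complex power exp(−(2πik/w)·log x). -/
open Real Complex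

open FourierTransform

theorem norm_Gamma_le_Gamma_re {s : ℂ} (hs : 0 < s.re) : ‖Complex.Gamma s‖ ≤ Real.Gamma s.re := by
  rw [Complex.Gamma_eq_integral hs, Real.Gamma_eq_integral hs, Complex.GammaIntegral]
  refine (MeasureTheory.norm_integral_le_integral_norm _).trans_eq ?_
  refine MeasureTheory.setIntegral_congr_fun measurableSet_Ioi fun t ht => ?_
  simp only [norm_mul, Complex.norm_real, Real.norm_eq_abs, Real.abs_exp,
    Complex.norm_cpow_eq_rpow_re_of_pos ht, Complex.sub_re, Complex.one_re]

theorem exists_norm_Gamma_le_div_sq : ∃ C : ℝ, ∀ ε t : ℝ, 0 ≤ ε → ε ≤ 1 → t ≠ 0 →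
    ‖Complex.Gamma (ε + t * I)‖ ≤ C / t ^ 2 := by
  obtain ⟨C, hC⟩ := (isCompact_Icc (a := (2 : ℝ)) (b := 3)).exists_bound_of_continuousOn
    (f := Real.Gamma) fun u hu => (Real.differentiableAt_Gamma fun m => by
      have : (0 : ℝ) ≤ m := m.cast_nonneg
      linarith [hu.1]).continuousAt.continuousWithinAt
  refine ⟨C, fun ε t h0 h1 ht => ?_⟩
  have ht' : 0 < |t| := abs_pos.2 ht
  have him : |t| ≤ ‖(ε + t * I : ℂ)‖ := by simpa using Complex.abs_im_le_norm (ε + t * I : ℂ)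
  have him1 : |t| ≤ ‖(ε + t * I + 1 : ℂ)‖ := by
    simpa using Complex.abs_im_le_norm (ε + t * I + 1 : ℂ)
  have hs : (ε + t * I : ℂ) ≠ 0 := norm_pos_iff.1 (ht'.trans_le him)
  have hs1 : (ε + t * I + 1 : ℂ) ≠ 0 := norm_pos_iff.1 (ht'.trans_le him1)
  have hre : (ε + t * I + 1 + 1 : ℂ).re = ε + 2 := by simp; ring
  have hG : ‖Complex.Gamma (ε + t * I + 1 + 1)‖ ≤ C := by
    refine (norm_Gamma_le_Gamma_re (by rw [hre]; linarith)).trans ?_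
    rw [hre]
    exact (le_abs_self _).trans (hC _ ⟨by linarith, by linarith⟩)
  rw [Complex.Gamma_add_one _ hs1, Complex.Gamma_add_one _ hs, norm_mul, norm_mul] at hG
  rw [le_div_iff₀ (by positivity), ← sq_abs]
  refine le_trans ?_ hG
  calc _ = |t| * (|t| * ‖Complex.Gamma (ε + t * I)‖) := by ring
    _ ≤ _ := by gcongr

theorem fourier_exp_mul_exp_neg_exp {x w ε : ℝ} (hx : 0 < x) (hw : 0 < w) (hε : 0 < ε) (ξ : ℝ) :
    𝓕 (fun u : ℝ => ((Real.exp (-(ε * w) * u) * Real.exp (-(x * Real.exp (-(w * u)))) : ℝ) : ℂ)) ξ =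
      (w : ℂ)⁻¹ * (Complex.Gamma (ε + 2 * π * I * ξ / w) *
        Complex.exp (-(ε + 2 * π * I * ξ / w) * Real.log x)) := by
  have hw' : (w : ℂ) ≠ 0 := by exact_mod_cast hw.ne'
  set s : ℂ := (ε * w : ℝ) + (2 * π * ξ : ℝ) * I with hs
  have hsw : s / w = ε + 2 * π * I * ξ / w := by
    rw [hs]; push_cast; field_simp
  have hre : 0 < (s / w).re := by
    rw [Complex.div_ofReal_re, hs]; simpa using by positivity
  have h := mellin_eq_fourier (fun t : ℝ => ((Real.exp (-(x * t ^ w)) : ℝ) : ℂ)) (s := s)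
  have h1 : s.im / (2 * π) = ξ := by simp [hs]
  have h2 : s.re = ε * w := by simp [hs]
  rw [h1, h2, mellin_comp_rpow (fun t => ((Real.exp (-(x * t)) : ℝ) : ℂ)),
    mellin_comp_mul_left (fun t => ((Real.exp (-t) : ℝ) : ℂ)) _ hx, ← Complex.GammaIntegral_eq_mellin,
    ← Complex.Gamma_eq_integral hre, abs_of_pos hw, hsw] at h
  calc _ = _ := by
        refine congrArg (fun g : ℝ → ℂ => 𝓕 g ξ) (funext fun u => ?_)
        rw [← Real.exp_mul]
        simp only [Complex.real_smul, Complex.ofReal_mul]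
        congr 5
        ring_nf
    _ = _ := h.symm
    _ = _ := by
        rw [Complex.cpow_def_of_ne_zero (by exact_mod_cast hx.ne'), ← Complex.ofReal_log hx.le]
        simp only [smul_eq_mul, Complex.real_smul, Complex.ofReal_inv]
        ring_nf

theorem exp_neg_mul_exp_le {x : ℝ} (hx : 0 < x) (y : ℝ) :
    Real.exp (-(x * Real.exp y)) ≤ 2 / x ^ 2 * Real.exp (-2 * y) := by
  have h := Real.pow_div_factorial_le_exp (x * Real.exp y) (by positivity) 2
  rw [Real.exp_neg, show -2 * y = -(y + y) by ring, Real.exp_neg, Real.exp_add]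
  have hy := Real.exp_pos y
  calc _ ≤ ((x * Real.exp y) ^ 2 / (Nat.factorial 2 : ℝ))⁻¹ := by gcongr
    _ = _ := by simp only [Nat.factorial]; push_cast; field_simp

theorem exp_mul_exp_neg_exp_le {x ε y : ℝ} (hx : 0 < x) (hε : ε ≤ 1) (hy : 0 ≤ y) :
    Real.exp (ε * y) * Real.exp (-(x * Real.exp y)) ≤ 2 / x ^ 2 * Real.exp (-y) := by
  calc _ ≤ Real.exp (1 * y) * (2 / x ^ 2 * Real.exp (-2 * y)) := by
        gcongr
        exact exp_neg_mul_exp_le hx y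
    _ = 2 / x ^ 2 * (Real.exp (1 * y) * Real.exp (-2 * y)) := by ring
    _ = _ := by rw [← Real.exp_add]; ring_nf

open Filter Asymptotics in
theorem isBigO_exp_mul_exp_neg_exp {x w ε : ℝ} (hx : 0 < x) (hw : 0 < w) (hε : 0 < ε)
    (hε1 : ε ≤ 1) :
    (fun u : ℝ => ((Real.exp (-(ε * w) * u) * Real.exp (-(x * Real.exp (-(w * u)))) : ℝ) : ℂ))
      =O[cocompact ℝ] fun u => |u| ^ (-2 : ℝ) := by
  have key : ∀ a : ℝ, 0 < a → (fun u : ℝ => Real.exp (-a * u)) =O[atTop] fun u => |u| ^ (-2 : ℝ) := by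
    intro a ha
    refine (isLittleO_exp_neg_mul_rpow_atTop ha (-2)).isBigO.congr' EventuallyEq.rfl ?_
    filter_upwards [eventually_ge_atTop 0] with u hu
    rw [abs_of_nonneg hu]
  rw [cocompact_eq_atBot_atTop, isBigO_sup]
  constructor
  · have h := (key w hw).comp_tendsto tendsto_neg_atBot_atTop
    refine IsBigO.trans ?_ (h.congr_right fun u => by simp)
    refine IsBigO.of_bound (2 / x ^ 2) ?_
    filter_upwards [eventually_le_atBot 0] with u hu
    have := exp_mul_exp_neg_exp_le (y := -(w * u)) hx hε1 (by nlinarith)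
    simp only [Function.comp_apply]
    rw [Complex.norm_real, Real.norm_of_nonneg (by positivity), Real.norm_of_nonneg (by positivity)]
    convert! this using 2
    all_goals simp; try ring_nf
  · refine IsBigO.trans (IsBigO.of_bound 1 (Eventually.of_forall fun u => ?_))
      (key (ε * w) (by positivity))
    rw [Complex.norm_real, Real.norm_of_nonneg (by positivity), Real.norm_of_nonneg (by positivity),
      one_mul]
    refine mul_le_of_le_one_right (by positivity) (Real.exp_le_one_iff.2 ?_)
    simpa using by positivity

/-- The value of `Γ(s) x ^ (-s)` at `s = ε + 2πik/w`. -/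
noncomputable def gammaTerm (x w ε : ℝ) (k : ℤ) : ℂ :=
  Complex.Gamma (ε + 2 * π * I * k / w) * Complex.exp (-(ε + 2 * π * I * k / w) * Real.log x)

theorem exists_summable_norm_gammaTerm_le (x : ℝ) {w : ℝ} (hw : 0 < w) : ∃ B : ℤ → ℝ, Summable B ∧
    ∀ ε : ℝ, 0 ≤ ε → ε ≤ 1 → ∀ k : ℤ, k ≠ 0 → ‖gammaTerm x w ε k‖ ≤ B k := by
  obtain ⟨C, hC⟩ := exists_norm_Gamma_le_div_sq
  refine ⟨fun k => C / (2 * π * k / w) ^ 2 * Real.exp |Real.log x|, ?_, fun ε h0 h1 k hk => ?_⟩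
  · have := (Real.summable_one_div_int_pow.2 one_lt_two).mul_left
      (C / (2 * π / w) ^ 2 * Real.exp |Real.log x|)
    refine this.congr fun k => ?_
    field_simp
  · have ht : 2 * π * k / w ≠ 0 := by
      have : (k : ℝ) ≠ 0 := by exact_mod_cast hk
      have := Real.pi_ne_zero
      positivity
    have hs : (ε + 2 * π * I * k / w : ℂ) = ε + (2 * π * k / w : ℝ) * I := by
      push_cast; ring
    have h := hC ε _ h0 h1 ht
    rw [gammaTerm, hs, norm_mul, Complex.norm_exp]
    refine mul_le_mul h (Real.exp_le_exp.2 ?_) (by positivity) ((norm_nonneg _).trans h)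
    have hre : (-(ε + (2 * π * k / w : ℝ) * I : ℂ) * Real.log x).re = -ε * Real.log x := by
      rw [Complex.re_mul_ofReal]; simp
    rw [hre]
    refine (le_abs_self _).trans ?_
    rw [abs_mul, abs_neg, abs_of_nonneg h0]
    exact mul_le_of_le_one_left (abs_nonneg _) h1

theorem summable_gammaTerm (x : ℝ) {w ε : ℝ} (hw : 0 < w) (h0 : 0 ≤ ε) (h1 : ε ≤ 1) :
    Summable (gammaTerm x w ε) := by
  obtain ⟨B, hB, h⟩ := exists_summable_norm_gammaTerm_le x hw
  refine Summable.of_norm_bounded_eventually hB ?_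
  filter_upwards [(Set.finite_singleton (0 : ℤ)).compl_mem_cofinite] with k hk
  exact h ε h0 h1 k hk

theorem tsum_exp_add_tsum_exp_eq_tsum_gammaTerm {x w ε : ℝ} (hx : 0 < x) (hw : 0 < w) (hε : 0 < ε)
    (hε1 : ε ≤ 1) :
    (w : ℂ) * ((∑' m : ℕ, ((Real.exp (ε * (w * m)) * Real.exp (-(x * Real.exp (w * m))) : ℝ) : ℂ)) +
      ∑' n : ℕ, ((Real.exp (-ε * (w * (n + 1))) *
        Real.exp (-(x * Real.exp (-(w * (n + 1))))) : ℝ) : ℂ)) = ∑' k : ℤ, gammaTerm x w ε k := by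
  have hw' : (w : ℂ) ≠ 0 := by exact_mod_cast hw.ne'
  obtain ⟨F, hF⟩ : ∃ F : ℝ → ℂ, F = fun u : ℝ =>
    ((Real.exp (-(ε * w) * u) * Real.exp (-(x * Real.exp (-(w * u)))) : ℝ) : ℂ) := ⟨_, rfl⟩
  have hO := isBigO_exp_mul_exp_neg_exp hx hw hε hε1
  rw [← hF] at hO
  have hc : Continuous F := by rw [hF]; fun_prop
  have hFT : ∀ k : ℤ, 𝓕 F k = (w : ℂ)⁻¹ * gammaTerm x w ε k := fun k => by
    rw [hF, fourier_exp_mul_exp_neg_exp hx hw hε, gammaTerm]; push_cast; rfl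
  have hsum : Summable fun k : ℤ => 𝓕 F k :=
    ((summable_gammaTerm x hw hε.le hε1).mul_left _).congr fun k => (hFT k).symm
  have hP := Real.tsum_eq_tsum_fourier_of_rpow_decay_of_summable hc one_lt_two hO hsum 0
  have hFs : Summable fun n : ℤ => F n := summable_of_isBigO (Real.summable_abs_int_rpow one_lt_two)
    (hO.comp_tendsto Int.tendsto_coe_cofinite)
  have hFs' : Summable fun n : ℤ => F (-n : ℤ) := (Equiv.neg ℤ).summable_iff.2 hFs
  have hs1 : Summable fun n : ℕ => F (-(n : ℤ) : ℤ) := hFs'.comp_injective Nat.cast_injective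
  have hs2 : Summable fun n : ℕ => F (-(-((n : ℤ) + 1)) : ℤ) :=
    hFs'.comp_injective (i := fun n : ℕ => (-((n : ℤ) + 1) : ℤ)) fun a b h => by simpa using h
  have hsplit := tsum_of_nat_of_neg_add_one (f := fun n : ℤ => F (-n : ℤ)) hs1 hs2
  have hneg : ∑' n : ℤ, F (-n : ℤ) = ∑' n : ℤ, F n := (Equiv.neg ℤ).tsum_eq fun n : ℤ => F n
  rw [hneg] at hsplit
  simp only [zero_add, QuotientAddGroup.mk_zero, fourier_eval_zero, mul_one, hFT] at hP
  rw [tsum_mul_left, hsplit] at hP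
  rw [eq_inv_mul_iff_mul_eq₀ hw'] at hP
  rw [← hP]
  congr 3 <;> refine funext fun n => ?_ <;> simp only [hF] <;> push_cast <;> ring_nf

theorem summable_exp_neg_mul_add_one {w : ℝ} (hw : 0 < w) :
    Summable fun n : ℕ => Real.exp (-(w * (n + 1))) := by
  refine ((summable_geometric_of_lt_one (Real.exp_pos (-w)).le
    (Real.exp_lt_one_iff.2 (by linarith))).mul_left (Real.exp (-w))).congr fun n => ?_
  rw [← Real.exp_nat_mul, ← Real.exp_add]; ring_nf

theorem tsum_exp_sub_one_eq_neg_tsum {x w : ℝ} (hx : 0 < x) (hw : 0 < w) :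
    ∑' n : ℕ, (Real.exp (-(x * Real.exp (-(w * (n + 1))))) - 1) =
      -∑' k : ℕ+, ((-1) ^ ((k : ℕ) + 1) / (Nat.factorial k) * x ^ (k : ℕ) /
        (Real.exp (w * k) - 1)) := by
  set a : ℕ → ℕ → ℝ := fun n j =>
    (-(x * Real.exp (-(w * (n + 1))))) ^ (j + 1) / (Nat.factorial (j + 1) : ℝ) with ha
  have hr0 : ∀ j : ℕ, Real.exp (-(w * (j + 1))) < 1 := fun j =>
    Real.exp_lt_one_iff.2 (by simpa using by positivity)
  have hexp : ∀ n j : ℕ, Real.exp (-(w * (n + 1))) ^ (j + 1) =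
      Real.exp (-(w * (j + 1))) * Real.exp (-(w * (j + 1))) ^ n := fun n j => by
    rw [← pow_succ', ← Real.exp_nat_mul, ← Real.exp_nat_mul]; push_cast; ring_nf
  have hrow : ∀ n, ∑' j, a n j = Real.exp (-(x * Real.exp (-(w * (n + 1))))) - 1 := fun n => by
    have h := NormedSpace.expSeries_div_hasSum_exp (-(x * Real.exp (-(w * (n + 1)))))
    rw [← Real.exp_eq_exp_ℝ, ← hasSum_nat_add_iff' 1] at h
    simpa using h.tsum_eq
  have hcol : ∀ j : ℕ, ∑' n, a n j = -((-1) ^ (j + 1 + 1) / (Nat.factorial (j + 1)) * x ^ (j + 1) /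
        (Real.exp (w * (j + 1 : ℕ)) - 1)) := fun j => by
    have h1 : 1 < Real.exp (w * (j + 1)) := Real.one_lt_exp_iff.2 (by positivity)
    have h2 : Real.exp (w * (j + 1)) - 1 ≠ 0 := by linarith
    have h3 : ∀ n, a n j = (-x) ^ (j + 1) / (Nat.factorial (j + 1) : ℝ) *
        Real.exp (-(w * (j + 1))) * Real.exp (-(w * (j + 1))) ^ n := fun n => by
      simp only [ha]
      rw [← neg_mul, mul_pow, hexp]; ring
    simp_rw [h3]
    rw [tsum_mul_left, tsum_geometric_of_lt_one (by positivity) (hr0 j), Real.exp_neg, neg_pow x]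
    push_cast
    have h4 : 1 - (Real.exp (w * (j + 1)))⁻¹ ≠ 0 := by
      have := inv_lt_one_of_one_lt₀ h1
      linarith
    field_simp
    ring
  have hs : Summable (Function.uncurry a) := by
    have hg := summable_exp_neg_mul_add_one hw
    have he : Summable fun j : ℕ => x ^ (j + 1) / (Nat.factorial (j + 1) : ℝ) :=
      (summable_nat_add_iff 1).2 (Real.summable_pow_div_factorial x)
    refine Summable.of_norm_bounded (hg.mul_of_nonneg he (fun _ => by positivity)
      fun _ => by positivity) fun ⟨n, j⟩ => ?_
    simp only [Function.uncurry, ha, norm_div, norm_pow, norm_neg, norm_mul, Real.norm_eq_abs,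
      Real.abs_exp, abs_of_pos hx, Nat.abs_cast, mul_pow]
    rw [mul_div_right_comm, mul_comm]
    gcongr
    exact pow_le_of_le_one (by positivity) (hr0 n).le (by simp)
  rw [tsum_pnat_eq_tsum_succ (f := fun k : ℕ => (-1 : ℝ) ^ (k + 1) / (Nat.factorial k) * x ^ k /
        (Real.exp (w * k) - 1)), ← tsum_neg]
  simp_rw [← hrow, ← hcol]
  exact (hs.tsum_comm).symm

open Filter Topology

theorem tendsto_inv_exp_sub_one_sub_inv :
    Tendsto (fun y : ℝ => (Real.exp y - 1)⁻¹ - y⁻¹) (𝓝[>] 0) (𝓝 (-1 / 2)) := by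
  have h1 : Tendsto (fun y : ℝ => (Real.exp y - 1) / y) (𝓝[>] 0) (𝓝 1) := by
    have := (Real.hasDerivAt_exp 0).tendsto_slope_zero_right
    simpa [div_eq_inv_mul] using this
  have h2 : Tendsto (fun y : ℝ => (Real.exp y - 1 - y) / y ^ 2) (𝓝[>] 0) (𝓝 (1 / 2)) := by
    rw [tendsto_iff_norm_sub_tendsto_zero]
    refine squeeze_zero' (g := fun y => y) (Eventually.of_forall fun _ => norm_nonneg _) ?_
      (tendsto_id.mono_left nhdsWithin_le_nhds)
    filter_upwards [Ioc_mem_nhdsGT (zero_lt_one (α := ℝ))] with y ⟨hy0, hy1⟩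
    have h := Real.exp_bound (x := y) (by rwa [abs_of_pos hy0]) (n := 3) (by norm_num)
    have e : (Real.exp y - 1 - y) / y ^ 2 - 1 / 2 = (Real.exp y - (1 + y + y ^ 2 / 2)) / y ^ 2 := by
      field_simp; ring
    rw [e, Real.norm_eq_abs, abs_div, abs_of_pos (by positivity : 0 < y ^ 2),
      div_le_iff₀ (by positivity)]
    simp [Finset.sum_range_succ, Nat.factorial, abs_of_pos hy0] at h
    nlinarith [pow_pos hy0 3]
  have h := (h2.div h1 one_ne_zero).neg
  rw [div_one, ← neg_div] at h
  refine h.congr' ?_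
  filter_upwards [self_mem_nhdsWithin] with y (hy : 0 < y)
  have : Real.exp y - 1 ≠ 0 := by linarith [Real.one_lt_exp_iff.2 hy]
  simp only [Pi.div_apply]
  field_simp
  ring

theorem tendsto_div_exp_sub_one_sub_Gamma (L : ℝ) {w : ℝ} (hw : 0 < w) :
    Tendsto (fun ε : ℝ => w * (Real.exp (ε * w) - 1)⁻¹ - Real.Gamma ε * Real.exp (-ε * L)) (𝓝[>] 0)
      (𝓝 (-w / 2 + Real.eulerMascheroniConstant + L)) := by
  have h1 : Tendsto (fun ε : ℝ => w * ((Real.exp (ε * w) - 1)⁻¹ - (ε * w)⁻¹)) (𝓝[>] 0)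
      (𝓝 (w * (-1 / 2))) := by
    refine (tendsto_inv_exp_sub_one_sub_inv.comp ?_).const_mul w
    refine tendsto_nhdsWithin_iff.2 ⟨?_, ?_⟩
    · have : Continuous fun ε : ℝ => ε * w := by fun_prop
      simpa using (this.tendsto 0).mono_left nhdsWithin_le_nhds
    · filter_upwards [self_mem_nhdsWithin] with ε (hε : 0 < ε)
      exact mul_pos hε hw
  have h2 : HasDerivAt (fun ε : ℝ => Real.Gamma (ε + 1) * Real.exp (-ε * L))
      (-Real.eulerMascheroniConstant - L) 0 := by
    have hG : HasDerivAt (fun ε : ℝ => Real.Gamma (ε + 1)) (-Real.eulerMascheroniConstant) 0 :=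
      HasDerivAt.comp_add_const 0 1 (by simpa using Real.hasDerivAt_Gamma_one)
    have hE : HasDerivAt (fun ε : ℝ => Real.exp (-ε * L)) (-L) 0 := by
      simpa using (((hasDerivAt_id (0 : ℝ)).neg).mul_const L).exp
    convert! hG.mul hE using 1
    simp; ring
  have h3 := h1.sub h2.tendsto_slope_zero_right
  convert! h3.congr' ?_ using 2
  · ring
  filter_upwards [self_mem_nhdsWithin] with ε (hε : 0 < ε)
  rw [zero_add, Real.Gamma_add_one hε.ne']
  simp only [zero_add, Real.Gamma_one, neg_zero, zero_mul, Real.exp_zero, smul_eq_mul]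
  field_simp
  ring

theorem gammaTerm_zero (x w ε : ℝ) :
    gammaTerm x w ε 0 = ((Real.Gamma ε * Real.exp (-ε * Real.log x) : ℝ) : ℂ) := by
  simp [gammaTerm, Complex.Gamma_ofReal]

theorem continuousAt_gammaTerm (x : ℝ) {w : ℝ} (hw : 0 < w) {k : ℤ} (hk : k ≠ 0) :
    ContinuousAt (fun ε => gammaTerm x w ε k) 0 := by
  have him : (((0 : ℝ) : ℂ) + 2 * π * I * k / w : ℂ).im ≠ 0 := by
    have hs : (((0 : ℝ) : ℂ) + 2 * π * I * k / w : ℂ) = (2 * π * k / w : ℝ) * I := by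
      push_cast; ring
    have : (k : ℝ) ≠ 0 := by exact_mod_cast hk
    have := Real.pi_ne_zero
    rw [hs, Complex.mul_I_im, Complex.ofReal_re]
    positivity
  have hΓ : ContinuousAt Complex.Gamma (((0 : ℝ) : ℂ) + 2 * π * I * k / w : ℂ) := by
    refine (Complex.differentiableAt_Gamma _ fun m h => him ?_).continuousAt
    rw [h]; simp
  have hl : Continuous fun ε : ℝ => (ε + 2 * π * I * k / w : ℂ) := by fun_prop
  exact (ContinuousAt.comp' (f := fun ε : ℝ => (ε + 2 * π * I * k / w : ℂ)) hΓ
    hl.continuousAt).mul (by fun_prop)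

theorem tendsto_tsum_exp_mul_exp_neg_exp {x w : ℝ} (hx : 0 < x) (hw : 0 < w) :
    Tendsto (fun ε : ℝ => ∑' m : ℕ,
      ((Real.exp (ε * (w * m)) * Real.exp (-(x * Real.exp (w * m))) : ℝ) : ℂ)) (𝓝[>] 0)
      (𝓝 (∑' m : ℕ, ((Real.exp (-(x * Real.exp (w * m))) : ℝ) : ℂ))) := by
  refine tendsto_tsum_of_dominated_convergence
    (bound := fun m : ℕ => 2 / x ^ 2 * Real.exp (-(w * m))) ?_ (fun m => ?_) ?_
  · refine Summable.mul_left _ ((summable_geometric_of_lt_one (Real.exp_pos (-w)).le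
        (Real.exp_lt_one_iff.2 (by linarith))).congr fun n => ?_)
    rw [← Real.exp_nat_mul]; ring_nf
  · have : Continuous fun ε : ℝ =>
      ((Real.exp (ε * (w * m)) * Real.exp (-(x * Real.exp (w * m))) : ℝ) : ℂ) := by fun_prop
    simpa using (this.tendsto 0).mono_left nhdsWithin_le_nhds
  · filter_upwards [Ioc_mem_nhdsGT (zero_lt_one (α := ℝ))] with ε ⟨h0, h1⟩ m
    rw [Complex.norm_real, Real.norm_of_nonneg (by positivity)]
    exact exp_mul_exp_neg_exp_le hx h1 (by positivity)

theorem tsum_exp_neg_mul_add_one {w : ℝ} (hw : 0 < w) :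
    ∑' n : ℕ, Real.exp (-(w * (n + 1))) = (Real.exp w - 1)⁻¹ := by
  have h : ∀ n : ℕ, Real.exp (-(w * (n + 1))) = Real.exp (-w) * Real.exp (-w) ^ n := fun n => by
    rw [← Real.exp_nat_mul, ← Real.exp_add]; ring_nf
  have h1 : 1 < Real.exp w := Real.one_lt_exp_iff.2 hw
  have h2 : Real.exp w - 1 ≠ 0 := by linarith
  have h4 : 1 - (Real.exp w)⁻¹ ≠ 0 := by
    have := inv_lt_one_of_one_lt₀ h1
    linarith
  simp_rw [h]
  rw [tsum_mul_left, tsum_geometric_of_lt_one (by positivity)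
    (Real.exp_lt_one_iff.2 (by linarith)), Real.exp_neg]
  field_simp

theorem norm_exp_sub_one_mul_le {x ε y : ℝ} (hx : 0 < x) (hε : 0 ≤ ε) (hy : 0 ≤ y) :
    ‖Real.exp (-ε * y) * (Real.exp (-(x * Real.exp (-y))) - 1)‖ ≤ x * Real.exp (-y) := by
  have h1 : Real.exp (-ε * y) ≤ 1 := Real.exp_le_one_iff.2 (by nlinarith [mul_nonneg hε hy])
  have h2 := Real.add_one_le_exp (-(x * Real.exp (-y)))
  have h3 : Real.exp (-(x * Real.exp (-y))) ≤ 1 :=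
    Real.exp_le_one_iff.2 (by simpa using by positivity)
  rw [norm_mul, Real.norm_of_nonneg (by positivity), Real.norm_eq_abs, abs_of_nonpos (by linarith)]
  refine (mul_le_of_le_one_left (by linarith) h1).trans (by linarith)

theorem tsum_exp_mul_exp_neg_exp_eq {x w ε : ℝ} (hx : 0 < x) (hw : 0 < w) (hε : 0 < ε) :
    ∑' n : ℕ, ((Real.exp (-ε * (w * (n + 1))) *
      Real.exp (-(x * Real.exp (-(w * (n + 1))))) : ℝ) : ℂ) =
    ((∑' n : ℕ, Real.exp (-ε * (w * (n + 1))) * (Real.exp (-(x * Real.exp (-(w * (n + 1))))) - 1) :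
      ℝ) : ℂ) + ((Real.exp (ε * w) - 1)⁻¹ : ℝ) := by
  rw [← Complex.ofReal_tsum, ← Complex.ofReal_add]
  congr 1
  have h : ∀ n : ℕ, Real.exp (-(ε * w * (n + 1))) = Real.exp (-ε * (w * (n + 1))) := fun n => by
    ring_nf
  rw [← tsum_exp_neg_mul_add_one (by positivity : 0 < ε * w), ← Summable.tsum_add]
  · refine tsum_congr fun n => ?_
    rw [h]; ring
  · exact Summable.of_norm_bounded ((summable_exp_neg_mul_add_one hw).mul_left x) fun n =>
      norm_exp_sub_one_mul_le hx hε.le (by positivity)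
  · exact summable_exp_neg_mul_add_one (by positivity)

theorem tendsto_tsum_exp_mul_exp_neg_exp_sub_one {x w : ℝ} (hx : 0 < x) (hw : 0 < w) :
    Tendsto (fun ε : ℝ => ∑' n : ℕ,
      Real.exp (-ε * (w * (n + 1))) * (Real.exp (-(x * Real.exp (-(w * (n + 1))))) - 1)) (𝓝[>] 0)
      (𝓝 (∑' n : ℕ, (Real.exp (-(x * Real.exp (-(w * (n + 1))))) - 1))) := by
  refine tendsto_tsum_of_dominated_convergence
    ((summable_exp_neg_mul_add_one hw).mul_left x) (fun n => ?_) ?_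
  · have : Continuous fun ε : ℝ => Real.exp (-ε * (w * (n + 1))) *
      (Real.exp (-(x * Real.exp (-(w * (n + 1))))) - 1) := by fun_prop
    simpa using (this.tendsto 0).mono_left nhdsWithin_le_nhds
  · filter_upwards [self_mem_nhdsWithin] with ε (hε : 0 < ε) n
    exact norm_exp_sub_one_mul_le hx hε.le (by positivity)

theorem tendsto_tsum_gammaTerm (x : ℝ) {w : ℝ} (hw : 0 < w) :
    Tendsto (fun ε : ℝ => ∑' k : {k : ℤ // k ≠ 0}, gammaTerm x w ε k) (𝓝[>] 0)
      (𝓝 (∑' k : {k : ℤ // k ≠ 0}, gammaTerm x w 0 k)) := by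
  obtain ⟨B, hB, h⟩ := exists_summable_norm_gammaTerm_le x hw
  refine tendsto_tsum_of_dominated_convergence (hB.subtype {k : ℤ | k ≠ 0}) (fun k => ?_) ?_
  · exact (continuousAt_gammaTerm x hw k.2).tendsto.mono_left nhdsWithin_le_nhds
  · filter_upwards [Ioc_mem_nhdsGT (zero_lt_one (α := ℝ))] with ε ⟨h0, h1⟩ k
    exact h ε h0.le h1 k k.2

theorem tsum_gammaTerm_eq {x w ε : ℝ} (hw : 0 < w) (h0 : 0 ≤ ε) (h1 : ε ≤ 1) :
    ∑' k : ℤ, gammaTerm x w ε k =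
      gammaTerm x w ε 0 + ∑' k : {k : ℤ // k ≠ 0}, gammaTerm x w ε k := by
  rw [← (summable_gammaTerm x hw h0 h1).tsum_subtype_add_tsum_subtype_compl {0}, tsum_singleton]
  rfl

/-- For all real `x > 0` and `w > 0`, Euler's constant satisfies
`γ = w/2 − log x − w·Σ_{k≥0} exp(−x e^{wk}) + w·Σ_{k≥1} ((−1)^{k+1}/k!)·x^k/(e^{wk}−1)
   + Σ_{k ∈ ℤ, k ≠ 0} Γ(2πik/w)·x^{−2πik/w}`. -/
theorem gamma_identity (x w : ℝ) (hx : 0 < x) (hw : 0 < w) :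
    (Real.eulerMascheroniConstant : ℂ) =
      (w : ℂ) / 2 - (Real.log x : ℂ)
      - (w : ℂ) * ∑' k : ℕ, ((Real.exp (-(x * Real.exp (w * k))) : ℝ) : ℂ)
      + (w : ℂ) * ∑' k : ℕ+, ((-1 : ℂ) ^ ((k : ℕ) + 1) / (Nat.factorial k) *
          (x : ℂ) ^ (k : ℕ) / ((Real.exp (w * k) : ℂ) - 1))
      + ∑' k : {k : ℤ // k ≠ 0},
          Complex.Gamma (2 * Real.pi * Complex.I * (k : ℤ) / w) *
            Complex.exp (-(2 * Real.pi * Complex.I * (k : ℤ) / w) * Real.log x) := by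
  have hP : ∑' k : ℕ+, ((-1 : ℂ) ^ ((k : ℕ) + 1) / (Nat.factorial k) *
      (x : ℂ) ^ (k : ℕ) / ((Real.exp (w * k) : ℂ) - 1)) =
      -((∑' n : ℕ, (Real.exp (-(x * Real.exp (-(w * (n + 1))))) - 1) : ℝ) : ℂ) := by
    rw [tsum_exp_sub_one_eq_neg_tsum hx hw, Complex.ofReal_neg, neg_neg, Complex.ofReal_tsum]
    refine tsum_congr fun k => ?_
    push_cast
    rfl
  have hS : ∑' k : {k : ℤ // k ≠ 0}, Complex.Gamma (2 * Real.pi * Complex.I * (k : ℤ) / w) *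
      Complex.exp (-(2 * Real.pi * Complex.I * (k : ℤ) / w) * Real.log x) =
      ∑' k : {k : ℤ // k ≠ 0}, gammaTerm x w 0 k := by
    simp only [gammaTerm, Complex.ofReal_zero, zero_add]
  have hlim := (((tendsto_tsum_exp_mul_exp_neg_exp hx hw).add
    ((Complex.continuous_ofReal.tendsto _).comp
      (tendsto_tsum_exp_mul_exp_neg_exp_sub_one hx hw))).const_mul (w : ℂ)).add
    ((Complex.continuous_ofReal.tendsto _).comp
      (tendsto_div_exp_sub_one_sub_Gamma (Real.log x) hw))
  have heq := tendsto_nhds_unique_of_eventuallyEq hlim (tendsto_tsum_gammaTerm x hw) (by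
    filter_upwards [Ioc_mem_nhdsGT (zero_lt_one (α := ℝ))] with ε ⟨h0, h1⟩
    have h := tsum_exp_add_tsum_exp_eq_tsum_gammaTerm hx hw h0 h1
    rw [tsum_gammaTerm_eq hw h0.le h1, gammaTerm_zero, tsum_exp_mul_exp_neg_exp_eq hx hw h0] at h
    simp only [Function.comp_apply]
    rw [Complex.ofReal_sub, Complex.ofReal_mul w]
    linear_combination h)
  rw [hP, hS, ← heq]
  push_cast
  ring
end

section
/- Let w > 0 be real and define φ_w(x) = Σ_{k=0}^{∞} exp(−x·e^{wk}) for x > 0. Then for every complex number a with Re(a) > 0, the Mellin transform of φ_w satisfies ∫_{0}^{∞} x^{a−1}·φ_w(x) dx = Γ(a)/(1 − e^{−a·w}), where Γ is the complex Gamma function and x^{a−1} denotes exp((a−1)·log x). -/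
open Real Complex MeasureTheory

lemma summable_exp_neg_mul_exp {w x : ℝ} (hw : 0 < w) (hx : 0 < x) :
    Summable fun k : ℕ ↦ Real.exp (-(x * Real.exp (w * k))) := by
  have hg : Summable fun k : ℕ ↦ Real.exp (k * (-(x * w))) :=
    Real.summable_exp_nat_mul_iff.mpr (neg_neg_of_pos (mul_pos hx hw))
  refine hg.of_nonneg_of_le (fun k ↦ (Real.exp_pos _).le) fun k ↦ Real.exp_le_exp.mpr ?_
  have h : w * k ≤ Real.exp (w * k) := by linarith [Real.add_one_le_exp (w * k)]
  linarith [mul_le_mul_of_nonneg_left h hx.le]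

lemma ofReal_exp_cpow (r : ℝ) (a : ℂ) : ((Real.exp r : ℝ) : ℂ) ^ a = Complex.exp (r * a) := by
  rw [Complex.cpow_def_of_ne_zero (by exact_mod_cast (Real.exp_pos r).ne'),
    ← Complex.ofReal_log (Real.exp_pos r).le, Real.log_exp]

/-- For `w > 0`, the Mellin transform of `φ_w(x) = Σ_{k≥0} exp(−x·e^{wk})` satisfies
`∫_0^∞ x^{a−1} φ_w(x) dx = Γ(a)/(1 − e^{−aw})` whenever `Re a > 0`. -/
theorem mellin_phi (w : ℝ) (hw : 0 < w) (a : ℂ) (ha : 0 < a.re) :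
    ∫ x in Set.Ioi (0 : ℝ),
        Complex.exp ((a - 1) * Real.log x) *
          ((∑' k : ℕ, Real.exp (-(x * Real.exp (w * k))) : ℝ) : ℂ) =
      Complex.Gamma a / (1 - Complex.exp (-a * w)) := by
  have hmellin : HasSum (fun k : ℕ ↦ Complex.Gamma a * 1 / (Real.exp (w * k) : ℂ) ^ a)
      (mellin (fun x ↦ ((∑' k : ℕ, Real.exp (-(x * Real.exp (w * k))) : ℝ) : ℂ)) a) := by
    refine hasSum_mellin (a := fun _ ↦ 1) (p := fun k : ℕ ↦ Real.exp (w * k))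
      (fun k ↦ Or.inr (Real.exp_pos _)) ha (fun x hx ↦ ?_) ?_
    · have h := (summable_exp_neg_mul_exp hw hx).hasSum
      simpa only [one_mul, neg_mul, mul_comm x] using Complex.hasSum_ofReal.mpr h
    · have hg : Summable fun k : ℕ ↦ Real.exp (k * (-(w * a.re))) :=
        Real.summable_exp_nat_mul_iff.mpr (neg_neg_of_pos (mul_pos hw ha))
      refine hg.congr fun k ↦ ?_
      rw [norm_one, one_div, ← Real.exp_mul, ← Real.exp_neg]
      congr 1
      ring
  have hnorm : ‖Complex.exp (-a * w)‖ < 1 := by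
    rw [Complex.norm_exp, Real.exp_lt_one_iff]
    simpa using mul_pos ha hw
  have hgeom : HasSum (fun k : ℕ ↦ Complex.Gamma a * 1 / (Real.exp (w * k) : ℂ) ^ a)
      (Complex.Gamma a / (1 - Complex.exp (-a * w))) := by
    rw [div_eq_mul_inv]
    have h := (hasSum_geometric_of_norm_lt_one hnorm).mul_left (Complex.Gamma a)
    refine (congrArg (HasSum · _) (funext fun k ↦ ?_)).mpr h
    rw [ofReal_exp_cpow, mul_one, div_eq_mul_inv, ← Complex.exp_neg, ← Complex.exp_nat_mul]
    congr 2
    push_cast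
    ring
  rw [← hmellin.unique hgeom, mellin]
  refine setIntegral_congr_fun measurableSet_Ioi fun x hx ↦ ?_
  have hx0 : (0 : ℝ) < x := hx
  simp only [smul_eq_mul]
  rw [Complex.cpow_def_of_ne_zero (by exact_mod_cast hx0.ne'), ← Complex.ofReal_log hx0.le,
    mul_comm (a - 1)]
end

section
/- For every real x > 0, Euler's constant satisfies γ = −log(x) − ∫_{0}^{∞} exp(−x·e^{u}) du + Σ_{k=1}^{∞} ((−1)^{k+1}/k)·x^{k}/k!. -/
open Real MeasureTheory

open Set in
/-- The integral representing `Γ'(1)` converges absolutely. -/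
lemma integrableOn_log_mul_exp_neg :
    IntegrableOn (fun t : ℝ ↦ log t * exp (-t)) (Ioi 0) := by
  have h : MellinConvergent (fun t ↦ log t • ((exp (-t) : ℝ) : ℂ)) 1 := by
    refine (mellin_hasDerivAt_of_isBigO_rpow (a := 2) (b := 0) ?_ ?_ (by norm_num) ?_
      (by norm_num)).1
    · exact Continuous.locallyIntegrable (by fun_prop) |>.locallyIntegrableOn _
    · rw [← Asymptotics.isBigO_norm_left]
      simp_rw [Complex.norm_real, Asymptotics.isBigO_norm_left]
      simpa only [neg_one_mul] using (isLittleO_exp_neg_mul_rpow_atTop zero_lt_one _).isBigO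
    · simp_rw [neg_zero, rpow_zero]
      have hc : Continuous fun t : ℝ ↦ ((exp (-t) : ℝ) : ℂ) := by fun_prop
      exact Asymptotics.isBigO_const_of_tendsto
        (hc.tendsto' 0 1 (by simp) |>.mono_left nhdsWithin_le_nhds) one_ne_zero
  have h2 : IntegrableOn
      (fun t : ℝ ↦ ((t : ℂ) ^ ((1 : ℂ) - 1) • log t • ((exp (-t) : ℝ) : ℂ)).re) (Ioi 0) := h.re
  refine h2.congr_fun (fun t _ ↦ ?_) measurableSet_Ioi
  simp [-Complex.ofReal_exp]

open Set in
lemma integral_log_mul_exp_neg :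
    ∫ t in Ioi (0 : ℝ), log t * exp (-t) = -eulerMascheroniConstant := by
  have h1 : HasDerivAt Complex.Gamma
      (∫ t in Ioi (0 : ℝ), (t : ℂ) ^ ((1 : ℂ) - 1) * (log t * exp (-t))) 1 := by
    refine (Complex.hasDerivAt_GammaIntegral (s := 1) (by simp)).congr_of_eventuallyEq ?_
    have : {s : ℂ | 0 < s.re} ∈ nhds 1 :=
      (isOpen_lt continuous_const Complex.continuous_re).mem_nhds (by simp)
    filter_upwards [this] with s hs using Complex.Gamma_eq_integral hs
  have h2 := h1.unique Complex.hasDerivAt_Gamma_one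
  simp only [sub_self, Complex.cpow_zero, one_mul] at h2
  norm_cast at h2

lemma hasSum_one_sub_exp_neg_div {t : ℝ} (ht : t ≠ 0) :
    HasSum (fun k : ℕ ↦ (-1) ^ k * t ^ k / (Nat.factorial (k + 1))) ((1 - exp (-t)) / t) := by
  have h := NormedSpace.expSeries_div_hasSum_exp (-t)
  rw [← Real.exp_eq_exp_ℝ, ← hasSum_nat_add_iff' 1] at h
  have hterm (k : ℕ) : (-1) ^ k * t ^ k / (Nat.factorial (k + 1) : ℝ) =
      -1 / t * ((-t) ^ (k + 1) / Nat.factorial (k + 1)) := by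
    rw [neg_pow]
    field_simp
    ring
  have hval : (1 - exp (-t)) / t =
      -1 / t * (exp (-t) - ∑ i ∈ Finset.range 1, (-t) ^ i / (Nat.factorial i : ℝ)) := by
    rw [Finset.sum_range_one, pow_zero, Nat.factorial_zero, Nat.cast_one, div_one]
    ring
  simpa only [hterm, hval] using h.mul_left (-1 / t)

open Set in
/-- The power series of the entire exponential integral. -/
lemma hasSum_integral_one_sub_exp_neg_div {x : ℝ} (hx : 0 < x) :
    HasSum (fun k : ℕ ↦ (-1) ^ k * x ^ (k + 1) / ((k + 1) * Nat.factorial (k + 1)))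
      (∫ t in 0..x, (1 - exp (-t)) / t) := by
  have key := intervalIntegral.hasSum_integral_of_dominated_convergence (μ := volume)
    (a := 0) (b := x)
    (F := fun (k : ℕ) (t : ℝ) ↦ (-1) ^ k * t ^ k / (Nat.factorial (k + 1)))
    (f := fun t ↦ (1 - exp (-t)) / t)
    (fun k _ ↦ x ^ k / (Nat.factorial k)) (fun k ↦ by fun_prop) (fun k ↦ ?_) ?_ ?_ ?_
  · have hterm (k : ℕ) : ∫ t in 0..x, (-1) ^ k * t ^ k / (Nat.factorial (k + 1) : ℝ) =
        (-1) ^ k * x ^ (k + 1) / ((k + 1) * Nat.factorial (k + 1)) := by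
      rw [intervalIntegral.integral_div, intervalIntegral.integral_const_mul, integral_pow,
        zero_pow k.succ_ne_zero, sub_zero]
      field_simp
    simpa only [hterm] using key
  · filter_upwards with t ht
    rw [uIoc_of_le hx.le] at ht
    rw [norm_div, norm_mul, norm_pow, norm_pow, norm_neg, norm_one, one_pow, one_mul,
      Real.norm_of_nonneg ht.1.le, RCLike.norm_natCast]
    gcongr
    · exact ht.1.le
    · exact ht.2
    · simp
  · filter_upwards with t _
    exact Real.summable_pow_div_factorial x
  · simp
  · filter_upwards with t ht
    rw [uIoc_of_le hx.le] at ht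
    exact hasSum_one_sub_exp_neg_div ht.1.ne'

open Set in
lemma integral_zero_log_mul_exp_neg {x : ℝ} (hx : 0 < x) :
    ∫ t in 0..x, log t * exp (-t) =
      (1 - exp (-x)) * log x - ∫ t in 0..x, (1 - exp (-t)) / t := by
  set g : ℝ → ℝ := dslope (fun t ↦ 1 - exp (-t)) 0 with hg
  have hgne {t : ℝ} (ht : t ≠ 0) : g t = (1 - exp (-t)) / t := by
    rw [hg, dslope_of_ne _ ht, slope_def_field]
    simp
  have hmul (t : ℝ) : t * g t = 1 - exp (-t) := by
    simpa using sub_smul_dslope (fun t : ℝ ↦ 1 - exp (-t)) 0 t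
  have hgc : Continuous g := by
    rw [continuous_iff_continuousAt]
    intro t
    by_cases ht : t = 0
    · subst ht
      exact continuousAt_dslope_same.2 (by fun_prop)
    · exact (continuousAt_dslope_of_ne ht).2 (by fun_prop)
  have hgi : ∫ t in 0..x, (1 - exp (-t)) / t = ∫ t in 0..x, g t := by
    refine intervalIntegral.integral_congr_ae ?_
    filter_upwards with t ht
    rw [uIoc_of_le hx.le] at ht
    exact (hgne ht.1.ne').symm
  have hF := intervalIntegral.integral_eq_sub_of_hasDerivAt_of_le hx.le
    (f := fun t ↦ (1 - exp (-t)) * log t - ∫ s in 0..t, g s)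
    (f' := fun t ↦ log t * exp (-t)) ?_ ?_ ?_
  · rw [hF, hgi]
    simp
  · have hc : Continuous fun t ↦ g t * (t * log t) - ∫ s in 0..t, g s :=
      (hgc.mul continuous_mul_log).sub
        (intervalIntegral.continuous_primitive (fun _ _ ↦ hgc.intervalIntegrable _ _) 0)
    convert hc.continuousOn using 3 with t
    rw [← hmul]
    ring
  · intro t ht
    have h1 : HasDerivAt (fun t ↦ 1 - exp (-t)) (exp (-t)) t := by
      simpa using ((hasDerivAt_neg t).exp.const_sub 1)
    have h2 := (h1.mul (hasDerivAt_log ht.1.ne')).sub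
      (intervalIntegral.integral_hasDerivAt_right (hgc.intervalIntegrable 0 t)
        hgc.stronglyMeasurable.stronglyMeasurableAtFilter hgc.continuousAt)
    refine h2.congr_deriv ?_
    rw [hgne ht.1.ne']
    ring
  · exact intervalIntegral.intervalIntegrable_log'.mul_continuousOn (by fun_prop)

open Set in
lemma integrableOn_exp_neg_div {x : ℝ} (hx : 0 < x) :
    IntegrableOn (fun t ↦ exp (-t) / t) (Ioi x) := by
  refine Integrable.mono' ((integrableOn_exp_neg_Ioi x).div_const x) ?_ ?_
  · exact (by fun_prop : Measurable fun t : ℝ ↦ exp (-t) / t).aestronglyMeasurable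
  · filter_upwards [ae_restrict_mem measurableSet_Ioi] with t ht
    have ht' : x < t := ht
    rw [Real.norm_of_nonneg (div_nonneg (exp_pos _).le (hx.trans ht').le)]
    gcongr

open Set Filter Topology in
lemma integral_Ioi_log_mul_exp_neg {x : ℝ} (hx : 0 < x) :
    ∫ t in Ioi x, log t * exp (-t) = exp (-x) * log x + ∫ t in Ioi x, exp (-t) / t := by
  have hi := integrableOn_log_mul_exp_neg.mono_set (Ioi_subset_Ioi hx.le)
  have hlim : Tendsto (fun t ↦ -(exp (-t) * log t)) atTop (𝓝 0) := by
    have h1 : Tendsto (fun t ↦ t * exp (-t)) atTop (𝓝 0) := by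
      simpa using tendsto_pow_mul_exp_neg_atTop_nhds_zero 1
    have h2 : Tendsto (fun t ↦ log t / t) atTop (𝓝 0) :=
      isLittleO_log_id_atTop.tendsto_div_nhds_zero
    have h3 := (h1.mul h2).neg
    rw [mul_zero, neg_zero] at h3
    refine h3.congr' ?_
    filter_upwards [eventually_gt_atTop 0] with t ht
    field_simp
  have h := integral_Ioi_of_hasDerivAt_of_tendsto' (a := x)
    (f' := fun t ↦ log t * exp (-t) - exp (-t) / t) (fun t ht ↦ ?_)
    (hi.sub (integrableOn_exp_neg_div hx)) hlim
  · rw [integral_sub hi (integrableOn_exp_neg_div hx)] at h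
    linarith
  · have ht0 : t ≠ 0 := (hx.trans_le ht).ne'
    refine (((hasDerivAt_neg t).exp).mul (hasDerivAt_log ht0)).neg.congr_deriv ?_
    ring

open Set in
lemma integral_exp_neg_mul_exp {x : ℝ} (hx : 0 < x) :
    ∫ u in Ioi (0 : ℝ), exp (-(x * exp u)) = ∫ t in Ioi x, exp (-t) / t := by
  have himg : (fun u ↦ x * exp u) '' Ioi 0 = Ioi x := by
    ext t
    constructor
    · rintro ⟨u, hu, rfl⟩
      exact lt_mul_of_one_lt_right hx (one_lt_exp_iff.2 hu)
    · intro ht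
      have ht' : x < t := ht
      refine ⟨log (t / x), log_pos ((one_lt_div hx).2 ht'), ?_⟩
      simp only [exp_log (div_pos (hx.trans ht') hx)]
      field_simp
  have h := integral_image_eq_integral_abs_deriv_smul (s := Ioi 0) measurableSet_Ioi
    (f := fun u ↦ x * exp u) (f' := fun u ↦ x * exp u)
    (fun u _ ↦ ((hasDerivAt_exp u).const_mul x).hasDerivWithinAt)
    (fun u _ v _ huv ↦ exp_injective (mul_left_cancel₀ hx.ne' huv))
    (fun t ↦ exp (-t) / t)
  rw [himg] at h
  rw [h]
  congr 1 with u
  rw [abs_of_pos (by positivity), smul_eq_mul]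
  field_simp

/-- For every real `x > 0`,
`γ = −log x − ∫_0^∞ exp(−x·e^u) du + Σ_{k≥1} ((−1)^{k+1}/k)·x^k/k!`. -/
theorem gamma_exponential_integral_series (x : ℝ) (hx : 0 < x) :
    Real.eulerMascheroniConstant =
      -Real.log x - (∫ u in Set.Ioi (0 : ℝ), Real.exp (-(x * Real.exp u)))
      + ∑' k : ℕ+, (-1 : ℝ) ^ ((k : ℕ) + 1) / (k : ℝ) * x ^ (k : ℕ) / (Nat.factorial k) := by
  have hsum : ∑' k : ℕ+, (-1 : ℝ) ^ ((k : ℕ) + 1) / (k : ℝ) * x ^ (k : ℕ) / (Nat.factorial k)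
      = ∫ t in 0..x, (1 - exp (-t)) / t := by
    rw [tsum_pnat_eq_tsum_succ
      (f := fun k : ℕ ↦ (-1 : ℝ) ^ (k + 1) / (k : ℝ) * x ^ k / (Nat.factorial k)),
      ← (hasSum_integral_one_sub_exp_neg_div hx).tsum_eq]
    refine tsum_congr fun k ↦ ?_
    push_cast
    field_simp
    ring
  have hsplit := intervalIntegral.integral_interval_add_Ioi integrableOn_log_mul_exp_neg
    (integrableOn_log_mul_exp_neg.mono_set (Set.Ioi_subset_Ioi hx.le))
  rw [integral_log_mul_exp_neg, integral_zero_log_mul_exp_neg hx,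
    integral_Ioi_log_mul_exp_neg hx] at hsplit
  rw [hsum, integral_exp_neg_mul_exp hx]
  linarith
end

section
/- For every real x > 0, Euler's constant satisfies γ = −log(x) − ∫_{x}^{∞} (e^{−u}/u) du + ∫_{0}^{x} ((1 − e^{−u})/u) du. -/
open Real MeasureTheory

open Set Filter Topology

/-- `-γ = ∫_0^∞ e^{-t} log t dt`. -/
theorem integral_log_mul_exp_neg_Ioi :
    ∫ t in Ioi (0 : ℝ), Real.log t * Real.exp (-t) = -Real.eulerMascheroniConstant := by
  have h1 := Complex.hasDerivAt_GammaIntegral (s := 1) (by simp)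
  have hev : Complex.Gamma =ᶠ[𝓝 1] Complex.GammaIntegral := by
    have : IsOpen {s : ℂ | 0 < s.re} := Complex.continuous_re.isOpen_preimage _ isOpen_Ioi
    filter_upwards [this.mem_nhds (show (1 : ℂ) ∈ {s : ℂ | 0 < s.re} by simp)] with s hs
    exact Complex.Gamma_eq_integral hs
  have h := (h1.congr_of_eventuallyEq hev).unique Complex.hasDerivAt_Gamma_one
  simp only [sub_self, Complex.cpow_zero, one_mul, ← Complex.ofReal_mul] at h
  rw [integral_complex_ofReal] at h
  exact_mod_cast h

theorem integrableOn_log_mul_exp_neg_Ioi :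
    IntegrableOn (fun t : ℝ => Real.log t * Real.exp (-t)) (Ioi 0) := by
  by_contra h
  have h0 := integral_undef h
  rw [integral_log_mul_exp_neg_Ioi] at h0
  linarith [Real.one_half_lt_eulerMascheroniConstant]

theorem abs_one_sub_exp_neg_div_le_one {t : ℝ} (ht : 0 < t) :
    |(1 - Real.exp (-t)) / t| ≤ 1 := by
  have h1 : Real.exp (-t) ≤ 1 := Real.exp_le_one_iff.2 (by linarith)
  rw [abs_of_nonneg (div_nonneg (by linarith) ht.le), div_le_one ht]
  linarith [Real.add_one_le_exp (-t)]

theorem intervalIntegrable_one_sub_exp_neg_div {x : ℝ} (hx : 0 < x) :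
    IntervalIntegrable (fun t : ℝ => (1 - Real.exp (-t)) / t) volume 0 x := by
  rw [intervalIntegrable_iff_integrableOn_Ioc_of_le hx.le]
  refine Measure.integrableOn_of_bounded (M := 1) (by simp)
    (Measurable.aestronglyMeasurable (by fun_prop)) ?_
  filter_upwards [ae_restrict_mem measurableSet_Ioc] with t ht
  exact abs_one_sub_exp_neg_div_le_one ht.1

theorem integrableOn_exp_neg_div_Ioi {x : ℝ} (hx : 0 < x) :
    IntegrableOn (fun t : ℝ => Real.exp (-t) / t) (Ioi x) := by
  refine Integrable.mono' ((integrableOn_exp_neg_Ioi x).div_const x)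
    (Measurable.aestronglyMeasurable (by fun_prop)) ?_
  filter_upwards [ae_restrict_mem measurableSet_Ioi] with t ht
  have ht' : x < t := ht
  rw [Real.norm_of_nonneg (div_nonneg (Real.exp_pos _).le (hx.trans ht').le)]
  gcongr

theorem tendsto_log_mul_one_sub_exp_neg_nhdsGT_zero :
    Tendsto (fun t : ℝ => Real.log t * (1 - Real.exp (-t))) (𝓝[>] 0) (𝓝 0) := by
  have h := (tendsto_log_mul_rpow_nhdsGT_zero one_pos).norm
  rw [norm_zero] at h
  refine squeeze_zero_norm' ?_ h
  filter_upwards [self_mem_nhdsWithin] with t (ht : 0 < t)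
  have h1 := abs_one_sub_exp_neg_div_le_one ht
  rw [abs_div, abs_of_pos ht, div_le_one ht] at h1
  rw [Real.rpow_one, norm_mul, norm_mul, Real.norm_of_nonneg ht.le]
  gcongr
  exact h1

theorem tendsto_log_mul_neg_exp_neg_atTop :
    Tendsto (fun t : ℝ => Real.log t * -Real.exp (-t)) atTop (𝓝 0) := by
  have h := Real.tendsto_pow_mul_exp_neg_atTop_nhds_zero 1
  refine squeeze_zero_norm' ?_ h
  filter_upwards [eventually_ge_atTop 1] with t ht
  rw [norm_mul, norm_neg, Real.norm_of_nonneg (Real.log_nonneg ht),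
    Real.norm_of_nonneg (Real.exp_pos _).le, pow_one]
  gcongr
  exact Real.log_le_self (by linarith)

theorem hasDerivAt_neg_exp_neg (t : ℝ) :
    HasDerivAt (fun t : ℝ => -Real.exp (-t)) (Real.exp (-t)) t := by
  simpa using (hasDerivAt_neg t).exp.fun_neg

theorem integral_log_mul_exp_neg_zero_left {x : ℝ} (hx : 0 < x) :
    ∫ t in (0 : ℝ)..x, Real.log t * Real.exp (-t) =
      Real.log x * (1 - Real.exp (-x)) - ∫ t in (0 : ℝ)..x, (1 - Real.exp (-t)) / t := by
  have hlog : IntervalIntegrable (fun t : ℝ => Real.log t * Real.exp (-t)) volume 0 x :=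
    (intervalIntegrable_iff_integrableOn_Ioc_of_le hx.le).2
      (integrableOn_log_mul_exp_neg_Ioi.mono_set Ioc_subset_Ioi_self)
  have hdiv := intervalIntegrable_one_sub_exp_neg_div hx
  have hderiv : ∀ t : ℝ, 0 < t → HasDerivAt (fun t : ℝ => Real.log t * (1 - Real.exp (-t)))
      ((1 - Real.exp (-t)) / t + Real.log t * Real.exp (-t)) t := by
    intro t ht
    refine ((Real.hasDerivAt_log ht.ne').fun_mul
      ((hasDerivAt_neg_exp_neg t).const_add 1)).congr_deriv ?_
    ring
  have h := intervalIntegral.integral_eq_sub_of_hasDerivAt_of_tendsto hx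
    (fun t ht => hderiv t ht.1) (hdiv.add hlog) tendsto_log_mul_one_sub_exp_neg_nhdsGT_zero
    ((hderiv x hx).continuousAt.tendsto.mono_left nhdsWithin_le_nhds)
  rw [intervalIntegral.integral_add hdiv hlog] at h
  linarith

theorem integral_log_mul_exp_neg_Ioi_of_pos {x : ℝ} (hx : 0 < x) :
    ∫ t in Ioi x, Real.log t * Real.exp (-t) =
      Real.log x * Real.exp (-x) + ∫ t in Ioi x, Real.exp (-t) / t := by
  have hlog : IntegrableOn (fun t : ℝ => Real.log t * Real.exp (-t)) (Ioi x) :=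
    integrableOn_log_mul_exp_neg_Ioi.mono_set (Ioi_subset_Ioi hx.le)
  have hdiv := integrableOn_exp_neg_div_Ioi hx
  have hderiv : ∀ t ∈ Ici x, HasDerivAt (fun t : ℝ => Real.log t * -Real.exp (-t))
      (Real.log t * Real.exp (-t) - Real.exp (-t) / t) t := by
    intro t ht
    refine ((Real.hasDerivAt_log (hx.trans_le ht).ne').fun_mul
      (hasDerivAt_neg_exp_neg t)).congr_deriv ?_
    ring
  have h := integral_Ioi_of_hasDerivAt_of_tendsto' hderiv (hlog.sub hdiv)
    tendsto_log_mul_neg_exp_neg_atTop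
  rw [integral_sub hlog hdiv] at h
  linarith

/-- For every real `x > 0`,
`γ = −log x − ∫_x^∞ e^{−u}/u du + ∫_0^x (1 − e^{−u})/u du`. -/
theorem gamma_exponential_integral (x : ℝ) (hx : 0 < x) :
    Real.eulerMascheroniConstant =
      -Real.log x - (∫ u in Set.Ioi x, Real.exp (-u) / u)
      + ∫ u in (0 : ℝ)..x, (1 - Real.exp (-u)) / u := by
  have hsplit := intervalIntegral.integral_interval_add_Ioi integrableOn_log_mul_exp_neg_Ioi
    (integrableOn_log_mul_exp_neg_Ioi.mono_set (Ioi_subset_Ioi hx.le))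
  rw [integral_log_mul_exp_neg_Ioi, integral_log_mul_exp_neg_zero_left hx,
    integral_log_mul_exp_neg_Ioi_of_pos hx] at hsplit
  linarith
end

section
/- Let w > 0 and x > 0 be real. The function f(a) = Γ(a)·x^{−a}/(1 − e^{−a·w}) of the complex variable a (where x^{−a} = exp(−a·log x)) has a pole at a = 0, and the residue of f at a = 0 equals 1/2 − γ/w − log(x)/w, where γ is the Euler–Mascheroni constant. -/
open Real Complex Filter Topology

/-- The derivative at `c` of the difference quotient of an entire function `f` based at `c`. -/
theorem deriv_dslope_same_of_differentiable {f : ℂ → ℂ} (hf : Differentiable ℂ f) (c : ℂ) :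
    deriv (dslope f c) c = deriv (deriv f) c / 2 := by
  have hd : Differentiable ℂ (dslope f c) := by
    rw [← differentiableOn_univ, Complex.differentiableOn_dslope univ_mem]
    exact hf.differentiableOn
  have hd' : Differentiable ℂ (deriv (dslope f c)) := fun z =>
    (hd.analyticAt z).deriv.differentiableAt
  have hf_eq : f = fun z => f c + (z - c) * dslope f c z := by
    funext z
    rw [← smul_eq_mul, sub_smul_dslope]
    ring
  have hderiv : deriv f = fun z => dslope f c z + (z - c) * deriv (dslope f c) z := by
    funext z
    have h := (((hasDerivAt_id z).sub_const c).mul (hd z).hasDerivAt).const_add (f c)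
    have h' : HasDerivAt f (1 * dslope f c z + (id z - c) * deriv (dslope f c) z) z := by
      rw [hf_eq]
      convert! h using 1
      rw [← hf_eq]
    simpa using h'.deriv
  have h := (hd c).hasDerivAt.add (((hasDerivAt_id c).sub_const c).mul (hd' c).hasDerivAt)
  have h' : HasDerivAt (deriv f) (deriv (dslope f c) c + (1 * deriv (dslope f c) c +
      (id c - c) * deriv (deriv (dslope f c)) c)) c := by
    rw [hderiv]
    exact h
  rw [h'.deriv]
  simp

/-- For real `w > 0`, `x > 0`, the function `f(a) = Γ(a)·x^{−a}/(1 − e^{−aw})` has a pole at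
`a = 0` (i.e. `‖f‖ → ∞` there), and its residue at `a = 0` — the value `R` with
`∮_{|a|=ε} f = 2πi·R` for all sufficiently small `ε > 0` — equals `1/2 − γ/w − log(x)/w`. -/
theorem residue_at_zero (w x : ℝ) (hw : 0 < w) (hx : 0 < x) :
    Tendsto (fun a : ℂ => ‖Complex.Gamma a * Complex.exp (-a * Real.log x) /
        (1 - Complex.exp (-a * w))‖) (𝓝[≠] (0 : ℂ)) atTop ∧
    ∃ ε₀ > (0 : ℝ), ∀ ε : ℝ, 0 < ε → ε < ε₀ →
      (∮ a in C(0, ε), Complex.Gamma a * Complex.exp (-a * Real.log x) /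
          (1 - Complex.exp (-a * w))) =
        2 * Real.pi * Complex.I *
          ((1 : ℂ) / 2 - (Real.eulerMascheroniConstant : ℂ) / w - (Real.log x : ℂ) / w) := by
  set D : ℂ → ℂ := fun a => 1 - Complex.exp (-a * w) with hD
  set g : ℂ → ℂ := fun a => Complex.Gamma (a + 1) * Complex.exp (-a * Real.log x) / dslope D 0 a
    with hg
  have hwC : (w : ℂ) ≠ 0 := by exact_mod_cast hw.ne'
  have hfac : ∀ a : ℂ, a ≠ 0 → Complex.Gamma a * Complex.exp (-a * Real.log x) /
      (1 - Complex.exp (-a * w)) = 1 / (a - 0) ^ 2 * g a := by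
    intro a ha
    have h : 1 - Complex.exp (-a * w) = a * dslope D 0 a := by
      have := sub_smul_dslope D 0 a
      simpa [hD] using this.symm
    rw [h, hg]
    simp only [Complex.Gamma_add_one a ha, sub_zero]
    by_cases h0 : dslope D 0 a = 0
    · simp [h0]
    · field_simp
  have hDdiff : Differentiable ℂ D := by fun_prop
  have hexp (c a : ℂ) : HasDerivAt (fun a : ℂ => Complex.exp (-a * c))
      (-c * Complex.exp (-a * c)) a := by
    convert! ((hasDerivAt_neg a).mul_const c).cexp using 1
    ring
  have hD' : deriv D = fun a => w * Complex.exp (-a * w) := by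
    funext a
    simpa [hD] using ((hexp w a).const_sub 1).deriv
  have hD'' : deriv (deriv D) 0 = -(w : ℂ) ^ 2 := by
    rw [hD', ((hexp w 0).const_mul (w : ℂ)).deriv]
    simp
    ring
  have hh : Differentiable ℂ (dslope D 0) := by
    rw [← differentiableOn_univ, Complex.differentiableOn_dslope univ_mem]
    exact hDdiff.differentiableOn
  have hh0 : dslope D 0 0 = w := by simp [dslope_same, hD']
  have hh' : HasDerivAt (dslope D 0) (-(w : ℂ) ^ 2 / 2) 0 := by
    rw [← hD'', ← deriv_dslope_same_of_differentiable hDdiff]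
    exact (hh 0).hasDerivAt
  have hΓ : HasDerivAt (fun a : ℂ => Complex.Gamma (a + 1)) (-Real.eulerMascheroniConstant) 0 := by
    apply HasDerivAt.comp_add_const
    simpa using Complex.hasDerivAt_Gamma_one
  have hg' : HasDerivAt g ((1 : ℂ) / 2 - (Real.eulerMascheroniConstant : ℂ) / w -
      (Real.log x : ℂ) / w) 0 := by
    refine ((hΓ.mul (hexp (Real.log x) 0)).div hh' (by rwa [hh0])).congr_deriv ?_
    simp only [hh0, Pi.mul_apply, neg_zero, zero_mul, Complex.exp_zero, zero_add,
      Complex.Gamma_one, mul_one]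
    field_simp
    ring
  have hg0 : g 0 = 1 / w := by simp only [hg, hh0]; simp
  have hgdiff : ∀ᶠ a in 𝓝 (0 : ℂ), DifferentiableAt ℂ g a := by
    have hre : ∀ᶠ a : ℂ in 𝓝 0, -1 < a.re :=
      Complex.continuous_re.continuousAt.eventually (lt_mem_nhds (by simp))
    filter_upwards [hh.continuous.continuousAt.eventually_ne (by rwa [hh0]), hre] with a ha hre
    refine DifferentiableAt.div (DifferentiableAt.mul ?_ (hexp _ a).differentiableAt) (hh a) ha
    refine ((Complex.differentiableAt_Gamma (a + 1) fun m hm =>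
      ?_).hasDerivAt.comp_add_const a 1).differentiableAt
    have := congrArg Complex.re hm
    simp at this
    have hm0 : (0 : ℝ) ≤ m := m.cast_nonneg
    linarith
  constructor
  · have hinv : Tendsto (fun a : ℂ => ‖1 / (a - 0) ^ 2‖) (𝓝[≠] 0) atTop := by
      simpa [Function.comp_def] using (tendsto_pow_atTop (two_ne_zero)).comp
        (tendsto_norm_inv_nhdsNE_zero_atTop (α := ℂ))
    have hgt : Tendsto (fun a => ‖g a‖) (𝓝[≠] 0) (𝓝 ‖g 0‖) :=
      hg'.continuousAt.norm.tendsto.mono_left nhdsWithin_le_nhds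
    refine (hinv.atTop_mul_pos (by simpa [hg0] using hw.ne') hgt).congr' ?_
    filter_upwards [self_mem_nhdsWithin] with a ha
    rw [hfac a ha, norm_mul]
  · obtain ⟨ε₀, hε₀, hball⟩ := Metric.eventually_nhds_iff_ball.1 hgdiff
    refine ⟨ε₀, hε₀, fun ε hε hlt => ?_⟩
    have hcl : DiffContOnCl ℂ g (Metric.ball 0 ε) := by
      refine DifferentiableOn.diffContOnCl fun a ha => ?_
      exact (hball a (Metric.closedBall_subset_ball hlt
        (Metric.closure_ball_subset_closedBall ha))).differentiableWithinAt
    rw [← hg'.deriv, ← smul_eq_mul (_ * _ * _), ← hcl.deriv_eq_smul_circleIntegral hε]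
    refine circleIntegral.integral_congr hε.le fun a ha => ?_
    exact hfac a (ne_of_mem_of_not_mem ha (by simp [hε.ne]))
end
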